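/- arXiv:2102.00597 — 2 statements merged into one kernel-verified Lean document; each statement's English description precedes it below -/
import Mathlib

section
/- Let C be a nontrivial linear code of length n over GF(q) and set d⊥ = d(C⊥). Then the minimum linear locality of C equals d⊥ − 1 if and only if the union of the supports of all codewords of Hamming weight d⊥ in C⊥ is equal to [n]. -/
open scoped BigOperators

variable {F : Type*} [Field F] {ι : Type*} [Fintype ι]

/-- The Hamming weight of a word: the number of nonzero coordinates. -/
noncomputable def wt (c : ι → F) : ℕ := {i | c i ≠ 0}.ncard

/-- The minimum distance of a linear code: the least Hamming weight of a nonzero codeword. -/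
noncomputable def minDist (C : Submodule F (ι → F)) : ℕ :=
  sInf {w | ∃ c ∈ C, c ≠ 0 ∧ wt c = w}

/-- The dual code of a linear code. -/
def dualCode (C : Submodule F (ι → F)) : Submodule F (ι → F) where
  carrier := {x | ∀ c ∈ C, ∑ i, x i * c i = 0}
  add_mem' := by
    intro a b ha hb c hc
    have h1 := ha c hc
    have h2 := hb c hc
    simp only [Set.mem_setOf_eq, Pi.add_apply, add_mul, Finset.sum_add_distrib, h1, h2, add_zero]
  zero_mem' := by intro c hc; simp
  smul_mem' := by
    intro r a ha c hc
    have h := ha c hc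
    simp only [Set.mem_setOf_eq, Pi.smul_apply, smul_eq_mul, mul_assoc, ← Finset.mul_sum, h,
      mul_zero]

/-- `C` has linear locality `r`: every code symbol `c i` is a fixed linear combination of
at most `r` other code symbols. -/
def HasLinearLocality (C : Submodule F (ι → F)) (r : ℕ) : Prop :=
  ∀ i : ι, ∃ (R : Finset ι) (u : ι → F), i ∉ R ∧ R.card ≤ r ∧
    ∀ c ∈ C, c i = ∑ j ∈ R, u j * c j

theorem mem_dualCode {C : Submodule F (ι → F)} {x : ι → F} :
    x ∈ dualCode C ↔ ∀ c ∈ C, ∑ i, x i * c i = 0 := Iff.rfl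

theorem minDist_le_wt {κ : Type*} {C : Submodule F (κ → F)} {c : κ → F} (hc : c ∈ C) (h0 : c ≠ 0) :
    minDist C ≤ wt c :=
  Nat.sInf_le ⟨c, hc, h0, rfl⟩

open Classical in
theorem wt_eq_card_filter (c : ι → F) : wt c = (Finset.univ.filter (c · ≠ 0)).card := by
  simp [wt, Set.ncard_eq_toFinset_card']

open Classical in
/-- A repair rule for the coordinate `i` using at most `r` other coordinates is the same as
a dual codeword of weight at most `r + 1` whose support contains `i`. -/
theorem hasLinearLocality_iff (C : Submodule F (ι → F)) (r : ℕ) :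
    HasLinearLocality C r ↔ ∀ i, ∃ x ∈ dualCode C, x i ≠ 0 ∧ wt x ≤ r + 1 := by
  refine forall_congr' fun i => ⟨?_, ?_⟩
  · rintro ⟨R, u, hi, hR, hu⟩
    refine ⟨fun j => (if j = i then 1 else 0) - if j ∈ R then u j else 0, ?_, ?_, ?_⟩
    · intro c hc
      simp [sub_mul, Finset.sum_sub_distrib, ite_mul, ← hu c hc]
    · simp [hi]
    · rw [wt_eq_card_filter]
      refine (Finset.card_le_card (t := insert i R) fun j hj => ?_).trans
        ((Finset.card_insert_le i R).trans (by omega))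
      by_contra h
      rw [Finset.mem_insert, not_or] at h
      simp [h.1, h.2] at hj
  · rintro ⟨x, hx, hxi, hw⟩
    have hmem : i ∈ Finset.univ.filter (x · ≠ 0) := by simpa using hxi
    refine ⟨(Finset.univ.filter (x · ≠ 0)).erase i, fun j => -(x i)⁻¹ * x j,
      Finset.notMem_erase _ _, ?_, fun c hc => ?_⟩
    · rw [Finset.card_erase_of_mem hmem, ← wt_eq_card_filter]
      omega
    · have h := mem_dualCode.1 hx c hc
      have hfilter : ∑ j ∈ Finset.univ.filter (x · ≠ 0), x j * c j = 0 :=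
        (Finset.sum_filter_of_ne fun j _ hj => left_ne_zero_of_mul hj).trans h
      rw [← Finset.add_sum_erase _ _ hmem] at hfilter
      simp only [mul_assoc]
      rw [← Finset.mul_sum, eq_neg_of_add_eq_zero_right hfilter]
      field_simp

/-- A nontrivial linear code `C` has minimum linear locality `d(C⊥) - 1` if and
only if the union of the supports of all codewords of Hamming weight `d(C⊥)` in `C⊥` is the whole
coordinate set. -/
theorem statement1 (C : Submodule F (ι → F))
    (h1 : 2 ≤ minDist C) (h2 : 2 ≤ minDist (dualCode C)) :
    IsLeast {r : ℕ | HasLinearLocality C r} (minDist (dualCode C) - 1) ↔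
      (⋃ c ∈ {c : ι → F | c ∈ dualCode C ∧ wt c = minDist (dualCode C)}, {i | c i ≠ 0})
        = Set.univ := by
  have hpos : 1 ≤ minDist (dualCode C) := by omega
  have hunion : (⋃ c ∈ {c : ι → F | c ∈ dualCode C ∧ wt c = minDist (dualCode C)},
      {i | c i ≠ 0}) = Set.univ ↔ HasLinearLocality C (minDist (dualCode C) - 1) := by
    rw [hasLinearLocality_iff, Nat.sub_add_cancel hpos, Set.eq_univ_iff_forall]
    refine forall_congr' fun i => ?_
    simp only [Set.mem_iUnion, Set.mem_ofPred_eq, exists_prop]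
    constructor
    · rintro ⟨x, ⟨hx, hw⟩, hxi⟩
      exact ⟨x, hx, hxi, hw.le⟩
    · rintro ⟨x, hx, hxi, hw⟩
      exact ⟨x, ⟨hx, hw.antisymm (minDist_le_wt hx (Function.ne_iff.2 ⟨i, hxi⟩))⟩, hxi⟩
  rw [hunion]
  refine ⟨fun h => h.1, fun h => ⟨h, fun r hr => ?_⟩⟩
  obtain ⟨c, -, hc, -⟩ := Nat.sInf_mem (Nat.nonempty_of_pos_sInf (show 0 < minDist C by omega))
  obtain ⟨i, -⟩ := Function.ne_iff.1 hc
  obtain ⟨x, hx, hxi, hw⟩ := (hasLinearLocality_iff C r).1 hr i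
  have := minDist_le_wt hx (Function.ne_iff.2 ⟨i, hxi⟩)
  omega
end

section
/- Let C be a nontrivial linear code of length n over GF(q) and set d⊥ = d(C⊥). Suppose there exists an integer λ ≥ 1 such that every coordinate i ∈ [n] lies in exactly λ of the distinct supports of the codewords of Hamming weight d⊥ in C⊥ (i.e., the supports of the minimum-weight codewords of C⊥ form a 1-(n, d⊥, λ) design). Then C has minimum linear locality d⊥ − 1. -/
open scoped BigOperators

variable {F : Type*} [Field F] {ι : Type*} [Fintype ι]

/-- A dual codeword of weight `w` that is nonzero at `i` expresses the `i`-th code symbol through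
`w - 1` other code symbols. -/
theorem exists_recovery_of_mem_dualCode {C : Submodule F (ι → F)} {x : ι → F}
    (hx : x ∈ dualCode C) {i : ι} (hi : x i ≠ 0) :
    ∃ (R : Finset ι) (u : ι → F), i ∉ R ∧ R.card ≤ wt x - 1 ∧
      ∀ c ∈ C, c i = ∑ j ∈ R, u j * c j := by
  classical
  have hmem : i ∈ Finset.univ.filter (fun j => x j ≠ 0) := by simpa using hi
  refine ⟨(Finset.univ.filter (fun j => x j ≠ 0)).erase i, fun j => -(x i)⁻¹ * x j,
    Finset.notMem_erase _ _, ?_, fun c hc => ?_⟩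
  · rw [Finset.card_erase_of_mem hmem, wt, ← Set.ncard_coe_finset]
    simp
  · have hsum : ∑ j ∈ Finset.univ.filter (fun j => x j ≠ 0), x j * c j = 0 := by
      rw [Finset.sum_filter_of_ne fun j _ hj => left_ne_zero_of_mul hj]
      exact mem_dualCode.1 hx c hc
    rw [← Finset.add_sum_erase _ _ hmem] at hsum
    simp only [mul_assoc, ← Finset.mul_sum]
    rw [← neg_eq_of_add_eq_zero_right hsum]
    field_simp

/-- Recovering the `i`-th code symbol from the symbols in `R` yields a nonzero dual codeword
supported on `insert i R`. -/
theorem minDist_dualCode_le_of_recovery {C : Submodule F (ι → F)} {i : ι} {R : Finset ι}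
    {u : ι → F} (hi : i ∉ R) (hu : ∀ c ∈ C, c i = ∑ j ∈ R, u j * c j) :
    minDist (dualCode C) ≤ R.card + 1 := by
  classical
  set x : ι → F := fun j => if j = i then 1 else if j ∈ R then -u j else 0 with hx
  have hxC : x ∈ dualCode C := by
    refine mem_dualCode.2 fun c hc => ?_
    rw [← Finset.sum_subset (Finset.subset_univ (insert i R)), Finset.sum_insert hi]
    · have hR : ∑ j ∈ R, x j * c j = -∑ j ∈ R, u j * c j := by
        rw [← Finset.sum_neg_distrib]
        refine Finset.sum_congr rfl fun j hj => ?_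
        simp [hx, hj, ne_of_mem_of_not_mem hj hi]
      rw [hR, ← hu c hc]
      simp [hx]
    · intro j _ hj
      simp only [Finset.mem_insert, not_or] at hj
      simp [hx, hj.1, hj.2]
  have hx0 : x ≠ 0 := fun h => by simpa [hx] using congrFun h i
  calc minDist (dualCode C) ≤ wt x := Nat.sInf_le ⟨x, hxC, hx0, rfl⟩
    _ ≤ (insert i R).card := by
      rw [wt, ← Set.ncard_coe_finset]
      refine Set.ncard_le_ncard (fun j hj => ?_) (Finset.finite_toSet _)
      by_contra h
      simp only [Finset.coe_insert, Set.mem_insert_iff, Finset.mem_coe, not_or] at h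
      exact hj (by simp [hx, h.1, h.2])
    _ = R.card + 1 := Finset.card_insert_of_notMem hi

/-- If the (distinct) supports of the minimum-weight codewords of `C⊥` form a
`1-(n, d⊥, λ)` design with `λ ≥ 1`, then the nontrivial code `C` has minimum linear locality
`d⊥ - 1`. -/
theorem statement3 (C : Submodule F (ι → F))
    (h1 : 2 ≤ minDist C) (h2 : 2 ≤ minDist (dualCode C)) (lam : ℕ) (hlam : 1 ≤ lam)
    (hdesign : ∀ i : ι,
      {S : Finset ι | (∃ c ∈ dualCode C, wt c = minDist (dualCode C) ∧
        (↑S : Set ι) = {j | c j ≠ 0}) ∧ i ∈ S}.ncard = lam) :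
    IsLeast {r : ℕ | HasLinearLocality C r} (minDist (dualCode C) - 1) := by
  refine ⟨fun i => ?_, fun r hr => ?_⟩
  · obtain ⟨S, ⟨c, hc, hw, hS⟩, hi⟩ :=
      Set.nonempty_of_ncard_ne_zero (Nat.ne_zero_of_lt (hlam.trans_eq (hdesign i).symm))
    have hci : i ∈ {j | c j ≠ 0} := hS ▸ Finset.mem_coe.2 hi
    exact hw ▸ exists_recovery_of_mem_dualCode hc hci
  · obtain ⟨_, c, -, hc, -⟩ := Nat.nonempty_of_pos_sInf (Nat.zero_lt_of_lt h1)
    obtain ⟨i, -⟩ := Function.ne_iff.1 hc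
    obtain ⟨R, u, hi, hR, hu⟩ := hr i
    have := minDist_dualCode_le_of_recovery hi hu
    omega
end
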